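/- arXiv:2105.01651 — 10 statements merged into one kernel-verified Lean document; each statement's English description precedes it below -/
import Mathlib

section
/- Let λ : ℝ^d → ℝ be a seminorm. For i = 1,…,n let μ_i, f_i : ℝ → ℝ be nondecreasing on [0,∞), subadditive on [0,∞), with μ_i(0) = f_i(0) = 0. Let G : ℝ → ℝ be twice differentiable on (0,∞) with G(θ) > 0, G'(θ) < 0 and G(θ)·G''(θ) ≤ 2·(G'(θ))² for all θ > 0, and with G(θ) → +∞ as θ → 0⁺. Let h : ℝ → ℝ satisfy h(0) = 0 and, for all x > 0, h(x) > 0 and G(h(x)) = 1/x. Define the pricing function Π(q, v) = ∑_{i=1}^n μ_i(f_i(h(λ(q)²/v))) for v > 0. Then Π is arbitrage free: for every m ≥ 1, every q, q_1, …, q_m ∈ ℝ^d, every v, v_1, …, v_m > 0 and every a_1, …, a_m ∈ ℝ such that ∑_{j=1}^m a_j·q_j = q and ∑_{j=1}^m a_j²·v_j ≤ v, one has Π(q, v) ≤ ∑_{j=1}^m Π(q_j, v_j). -/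
theorem aux_superadd (G G' G'' : ℝ → ℝ)
    (hG_deriv : ∀ θ : ℝ, 0 < θ → HasDerivAt G (G' θ) θ)
    (hG'_deriv : ∀ θ : ℝ, 0 < θ → HasDerivAt G' (G'' θ) θ)
    (hG_pos : ∀ θ : ℝ, 0 < θ → 0 < G θ)
    (hG_ineq : ∀ θ : ℝ, 0 < θ → G θ * G'' θ ≤ 2 * (G' θ) ^ 2)
    (hG_top : Filter.Tendsto G (nhdsWithin 0 (Set.Ioi 0)) Filter.atTop)
    (s t : ℝ) (hs : 0 < s) (ht : 0 < t) :
    (G s)⁻¹ + (G t)⁻¹ ≤ (G (s + t))⁻¹ := by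
  have hF : ∀ θ : ℝ, 0 < θ → HasDerivAt (fun x => (G x)⁻¹) (-G' θ / G θ ^ 2) θ :=
    fun θ hθ => (hG_deriv θ hθ).fun_inv (hG_pos θ hθ).ne'
  have hF' : ∀ θ : ℝ, 0 < θ → HasDerivAt (fun x => -G' x / G x ^ 2)
      ((-G'' θ * G θ ^ 2 - -G' θ * (2 * G θ * G' θ)) / (G θ ^ 2) ^ 2) θ := by
    intro θ hθ
    have h1 := (hG'_deriv θ hθ).fun_neg.fun_div ((hG_deriv θ hθ).fun_pow 2)
      (pow_ne_zero 2 (hG_pos θ hθ).ne')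
    simpa using h1
  have hmono' : MonotoneOn (fun x => -G' x / G x ^ 2) (Set.Ioi 0) := by
    apply monotoneOn_of_deriv_nonneg (convex_Ioi 0)
    · exact fun x hx => (hF' x hx).continuousAt.continuousWithinAt
    · rw [interior_Ioi]
      exact fun x hx => (hF' x hx).differentiableAt.differentiableWithinAt
    · rw [interior_Ioi]
      intro x hx
      rw [(hF' x hx).deriv]
      apply div_nonneg _ (by positivity)
      have h1 := hG_ineq x hx
      have h2 := hG_pos x hx
      nlinarith [mul_nonneg h2.le (sub_nonneg.2 h1)]
  have hφ : ∀ x : ℝ, 0 < x → HasDerivAt (fun x => (G (s + x))⁻¹ - (G x)⁻¹)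
      (-G' (s + x) / G (s + x) ^ 2 - -G' x / G x ^ 2) x := fun x hx =>
    ((hF (s + x) (add_pos hs hx)).comp_const_add s x).fun_sub (hF x hx)
  have hφm : MonotoneOn (fun x => (G (s + x))⁻¹ - (G x)⁻¹) (Set.Ioi 0) := by
    apply monotoneOn_of_deriv_nonneg (convex_Ioi 0)
    · exact fun x hx => (hφ x hx).continuousAt.continuousWithinAt
    · rw [interior_Ioi]
      exact fun x hx => (hφ x hx).differentiableAt.differentiableWithinAt
    · rw [interior_Ioi]
      intro x hx
      rw [(hφ x hx).deriv]
      have hx' : (0 : ℝ) < x := hx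
      exact sub_nonneg.2 (hmono' hx (Set.mem_Ioi.2 (add_pos hs hx')) (by linarith))
  have hlim : Filter.Tendsto (fun x => (G (s + x))⁻¹ - (G x)⁻¹)
      (nhdsWithin 0 (Set.Ioi 0)) (nhds ((G s)⁻¹ - 0)) := by
    apply Filter.Tendsto.sub
    · have hc : ContinuousAt (fun x => (G (s + x))⁻¹) 0 := by
        have h1 := hF (s + 0) (by simpa using hs)
        exact (h1.comp_const_add s 0).continuousAt
      have h2 := hc.tendsto
      simp only [add_zero] at h2
      exact h2.mono_left nhdsWithin_le_nhds
    · exact hG_top.inv_tendsto_atTop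
  have hle : (G s)⁻¹ - 0 ≤ (G (s + t))⁻¹ - (G t)⁻¹ := by
    apply le_of_tendsto hlim
    filter_upwards [Ioo_mem_nhdsGT ht] with x hx
    exact hφm hx.1 ht hx.2.le
  linarith

theorem aux_sum (K : ℝ → ℝ) (hK0 : K 0 = 0)
    (hsub : ∀ x y : ℝ, 0 ≤ x → 0 ≤ y → K (x + y) ≤ K x + K y)
    {m : ℕ} (s : Finset (Fin m)) (x : Fin m → ℝ) (hx : ∀ j, 0 ≤ x j) :
    K (∑ j ∈ s, x j) ≤ ∑ j ∈ s, K (x j) := by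
  classical
  induction s using Finset.induction_on with
  | empty => simp [hK0]
  | insert a s ha ih =>
    rw [Finset.sum_insert ha, Finset.sum_insert ha]
    have := hsub (x a) (∑ j ∈ s, x j) (hx a) (Finset.sum_nonneg fun j _ => hx j)
    linarith

/-- Theorem 1 of the paper: the pricing function
`price q v = ∑ i, μ i (f i (h (lam q ^ 2 / v)))` is arbitrage free. -/
theorem stmt_0 (d n : ℕ)
    (lam : (Fin d → ℝ) → ℝ)
    (hlam_smul : ∀ (c : ℝ) (q : Fin d → ℝ), lam (c • q) = |c| * lam q)
    (hlam_add : ∀ q q' : Fin d → ℝ, lam (q + q') ≤ lam q + lam q')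
    (μ f : Fin n → ℝ → ℝ)
    (hμ_mono : ∀ i, ∀ x y : ℝ, 0 ≤ x → x ≤ y → μ i x ≤ μ i y)
    (hμ_sub : ∀ i, ∀ x y : ℝ, 0 ≤ x → 0 ≤ y → μ i (x + y) ≤ μ i x + μ i y)
    (hμ0 : ∀ i, μ i 0 = 0)
    (hf_mono : ∀ i, ∀ x y : ℝ, 0 ≤ x → x ≤ y → f i x ≤ f i y)
    (hf_sub : ∀ i, ∀ x y : ℝ, 0 ≤ x → 0 ≤ y → f i (x + y) ≤ f i x + f i y)
    (hf0 : ∀ i, f i 0 = 0)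
    (G G' G'' : ℝ → ℝ)
    (hG_deriv : ∀ θ : ℝ, 0 < θ → HasDerivAt G (G' θ) θ)
    (hG'_deriv : ∀ θ : ℝ, 0 < θ → HasDerivAt G' (G'' θ) θ)
    (hG_pos : ∀ θ : ℝ, 0 < θ → 0 < G θ)
    (hG'_neg : ∀ θ : ℝ, 0 < θ → G' θ < 0)
    (hG_ineq : ∀ θ : ℝ, 0 < θ → G θ * G'' θ ≤ 2 * (G' θ) ^ 2)
    (hG_top : Filter.Tendsto G (nhdsWithin 0 (Set.Ioi 0)) Filter.atTop)
    (h : ℝ → ℝ)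
    (hh0 : h 0 = 0)
    (hh_pos : ∀ x : ℝ, 0 < x → 0 < h x)
    (hh_inv : ∀ x : ℝ, 0 < x → G (h x) = 1 / x)
    (price : (Fin d → ℝ) → ℝ → ℝ)
    (hprice : ∀ (q : Fin d → ℝ) (v : ℝ), 0 < v →
      price q v = ∑ i, μ i (f i (h (lam q ^ 2 / v))))
    (m : ℕ) (hm : 1 ≤ m)
    (q : Fin d → ℝ) (qs : Fin m → (Fin d → ℝ))
    (v : ℝ) (vs : Fin m → ℝ) (hv : 0 < v) (hvs : ∀ j, 0 < vs j)
    (a : Fin m → ℝ)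
    (hq : ∑ j, a j • qs j = q)
    (hvsum : ∑ j, (a j) ^ 2 * vs j ≤ v) :
    price q v ≤ ∑ j, price (qs j) (vs j) := by
  have hanti : StrictAntiOn G (Set.Ioi 0) := by
    apply strictAntiOn_of_deriv_neg (convex_Ioi 0)
    · exact fun x hx => (hG_deriv x hx).continuousAt.continuousWithinAt
    · rw [interior_Ioi]
      intro x hx
      rw [(hG_deriv x hx).deriv]
      exact hG'_neg x hx
  have hh_nonneg : ∀ x : ℝ, 0 ≤ x → 0 ≤ h x := by
    intro x hx
    rcases hx.eq_or_lt with rfl | hx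
    · rw [hh0]
    · exact (hh_pos x hx).le
  have hh_mono : ∀ x y : ℝ, 0 ≤ x → x ≤ y → h x ≤ h y := by
    intro x y hx hxy
    rcases hx.eq_or_lt with rfl | hx
    · rw [hh0]; exact hh_nonneg y hxy
    · have hy := hx.trans_le hxy
      by_contra! hc
      have h1 := hanti (hh_pos y hy) (hh_pos x hx) hc
      rw [hh_inv x hx, hh_inv y hy] at h1
      exact absurd (one_div_le_one_div_of_le hx hxy) (not_le.2 h1)
  have hh_sub : ∀ x y : ℝ, 0 ≤ x → 0 ≤ y → h (x + y) ≤ h x + h y := by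
    intro x y hx hy
    rcases hx.eq_or_lt with rfl | hx
    · simp [hh0]
    rcases hy.eq_or_lt with rfl | hy
    · simp [hh0]
    by_contra! hc
    have hp := add_pos (hh_pos x hx) (hh_pos y hy)
    have h1 := hanti hp (hh_pos _ (add_pos hx hy)) hc
    have h2 := aux_superadd G G' G'' hG_deriv hG'_deriv hG_pos hG_ineq hG_top
      (h x) (h y) (hh_pos x hx) (hh_pos y hy)
    rw [hh_inv x hx, hh_inv y hy] at h2
    rw [hh_inv _ (add_pos hx hy)] at h1
    have h3 := inv_strictAnti₀ (one_div_pos.2 (add_pos hx hy)) h1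
    simp only [one_div, inv_inv] at h2 h3
    linarith
  have hf_nonneg : ∀ i, ∀ x : ℝ, 0 ≤ x → 0 ≤ f i x := fun i x hx => by
    have := hf_mono i 0 x le_rfl hx
    rwa [hf0] at this
  have hlam0 : lam 0 = 0 := by simpa using hlam_smul 0 0
  have hlam_nonneg : ∀ p, 0 ≤ lam p := by
    intro p
    have h1 := hlam_add p ((-1 : ℝ) • p)
    rw [hlam_smul] at h1
    simp [hlam0] at h1
    linarith
  have hlam_sum : ∀ s : Finset (Fin m), lam (∑ j ∈ s, a j • qs j) ≤ ∑ j ∈ s, |a j| * lam (qs j) := by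
    classical
    intro s
    induction s using Finset.induction_on with
    | empty => simp [hlam0]
    | insert b s hb ih =>
      rw [Finset.sum_insert hb, Finset.sum_insert hb]
      have := hlam_add (a b • qs b) (∑ j ∈ s, a j • qs j)
      rw [hlam_smul] at this
      linarith
  have hx : ∀ j, 0 ≤ lam (qs j) ^ 2 / vs j := fun j => div_nonneg (sq_nonneg _) (hvs j).le
  have hkey : lam q ^ 2 / v ≤ ∑ j, lam (qs j) ^ 2 / vs j := by
    rw [div_le_iff₀ hv]
    have h1 : lam q ≤ ∑ j, |a j| * lam (qs j) := hq ▸ hlam_sum Finset.univ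
    have h2 : (∑ j, |a j| * lam (qs j)) ^ 2 ≤
        (∑ j, lam (qs j) ^ 2 / vs j) * ∑ j, a j ^ 2 * vs j := by
      apply Finset.sum_sq_le_sum_mul_sum_of_sq_eq_mul
      · exact fun j _ => hx j
      · exact fun j _ => mul_nonneg (sq_nonneg _) (hvs j).le
      · intro j _
        have := (hvs j).ne'
        rw [mul_pow, sq_abs]
        field_simp
    calc lam q ^ 2 ≤ (∑ j, |a j| * lam (qs j)) ^ 2 := pow_le_pow_left₀ (hlam_nonneg q) h1 2
      _ ≤ _ := h2
      _ ≤ _ := mul_le_mul_of_nonneg_left hvsum (Finset.sum_nonneg fun j _ => hx j)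
  have hR : ∑ j, price (qs j) (vs j) =
      ∑ j, ∑ i, μ i (f i (h (lam (qs j) ^ 2 / vs j))) :=
    Finset.sum_congr rfl fun j _ => hprice _ _ (hvs j)
  rw [hprice q v hv, hR, Finset.sum_comm]
  apply Finset.sum_le_sum
  intro i _
  have hKm : ∀ x y : ℝ, 0 ≤ x → x ≤ y → μ i (f i (h x)) ≤ μ i (f i (h y)) := fun x y hx hxy =>
    hμ_mono i _ _ (hf_nonneg i _ (hh_nonneg x hx))
      (hf_mono i _ _ (hh_nonneg x hx) (hh_mono x y hx hxy))
  refine (hKm _ _ (div_nonneg (sq_nonneg _) hv.le) hkey).trans ?_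
  refine aux_sum (fun x => μ i (f i (h x))) (by simp [hh0, hf0, hμ0]) ?_ Finset.univ _ hx
  intro x y hx hy
  have hx' := hh_nonneg x hx
  have hy' := hh_nonneg y hy
  exact (hμ_mono i _ _ (hf_nonneg i _ (hh_nonneg _ (add_nonneg hx hy)))
    ((hf_mono i _ _ (hh_nonneg _ (add_nonneg hx hy)) (hh_sub x y hx hy)).trans
      (hf_sub i _ _ hx' hy'))).trans (hμ_sub i _ _ (hf_nonneg i _ hx') (hf_nonneg i _ hy'))
end

section
/- Let 0 < θ_L ≤ θ_U and let F : ℝ → ℝ be twice differentiable on [θ_L, θ_U] with F''(θ) ≥ 0 for all θ ∈ [θ_L, θ_U]. Suppose F(θ) + F(θ_L) ≤ F(θ + θ_L) for all θ with θ_L ≤ θ ≤ θ_U − θ_L. Then for all θ₁, θ₂ ≥ θ_L with θ₁ + θ₂ ≤ θ_U, one has F(θ₁) + F(θ₂) ≤ F(θ₁ + θ₂). -/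
/-- Constrained superadditivity: a convex function on `[θL, θU]` superadditive
against the increment `θL` is superadditive for pairs of arguments `≥ θL`
whose sum stays within the interval. -/
theorem stmt_5 (θL θU : ℝ) (hL : 0 < θL) (hLU : θL ≤ θU)
    (F F' F'' : ℝ → ℝ)
    (hd1 : ∀ θ ∈ Set.Icc θL θU, HasDerivAt F (F' θ) θ)
    (hd2 : ∀ θ ∈ Set.Icc θL θU, HasDerivAt F' (F'' θ) θ)
    (hconv : ∀ θ ∈ Set.Icc θL θU, 0 ≤ F'' θ)
    (hbase : ∀ θ : ℝ, θL ≤ θ → θ ≤ θU - θL → F θ + F θL ≤ F (θ + θL)) :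
    ∀ θ₁ θ₂ : ℝ, θL ≤ θ₁ → θL ≤ θ₂ → θ₁ + θ₂ ≤ θU →
      F θ₁ + F θ₂ ≤ F (θ₁ + θ₂) := by
  intro a b ha hb hab
  have hmono : MonotoneOn F' (Set.Icc θL θU) := by
    apply monotoneOn_of_deriv_nonneg (convex_Icc _ _)
    · exact fun x hx => (hd2 x hx).continuousAt.continuousWithinAt
    · exact fun x hx => (hd2 x (interior_subset hx)).differentiableAt.differentiableWithinAt
    · intro x hx
      rw [(hd2 x (interior_subset hx)).deriv]
      exact hconv x (interior_subset hx)
  have hG : ∀ t ∈ Set.Icc θL b,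
      HasDerivAt (fun t => F (a + t) - F t) (F' (a + t) - F' t) t := by
    intro t ht
    have h1 : HasDerivAt F (F' (a + t)) (a + t) :=
      hd1 _ ⟨by linarith [ht.1], by linarith [ht.2]⟩
    exact (h1.comp_const_add a t).sub (hd1 t ⟨ht.1, by linarith [ht.2]⟩)
  have hGm : MonotoneOn (fun t => F (a + t) - F t) (Set.Icc θL b) := by
    apply monotoneOn_of_deriv_nonneg (convex_Icc _ _)
    · exact fun x hx => (hG x hx).continuousAt.continuousWithinAt
    · exact fun x hx => (hG x (interior_subset hx)).differentiableAt.differentiableWithinAt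
    · intro x hx
      have hx' := interior_subset hx
      rw [(hG x hx').deriv]
      have := hmono (a := x) (b := a + x) ⟨hx'.1, by linarith [hx'.2]⟩
        ⟨by linarith [hx'.1], by linarith [hx'.2]⟩ (by linarith)
      linarith
  have h := hGm (Set.left_mem_Icc.2 hb) (Set.right_mem_Icc.2 hb) hb
  have h2 := hbase a ha (by linarith)
  simp only at h
  linarith
end

section
/- Let 0 < x₀ and x₀ ≤ X, and let h : ℝ → ℝ be twice differentiable on [x₀, X] with h''(x) ≤ 0 for all x ∈ [x₀, X]. Suppose 2·x₀ ≤ X and h(2·x₀) ≤ 2·h(x₀). Then for all x₁, x₂ ≥ x₀ with x₁ + x₂ ≤ X, one has h(x₁ + x₂) ≤ h(x₁) + h(x₂). -/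
/-- Constrained subadditivity: a concave function on `[x₀, X]` with
`h(2x₀) ≤ 2h(x₀)` is subadditive for pairs of arguments `≥ x₀` whose sum
stays within the interval. -/
theorem stmt_7 (x₀ X : ℝ) (hx₀ : 0 < x₀) (hx₀X : x₀ ≤ X)
    (h h' h'' : ℝ → ℝ)
    (hd1 : ∀ x ∈ Set.Icc x₀ X, HasDerivAt h (h' x) x)
    (hd2 : ∀ x ∈ Set.Icc x₀ X, HasDerivAt h' (h'' x) x)
    (hconc : ∀ x ∈ Set.Icc x₀ X, h'' x ≤ 0)
    (hdouble : 2 * x₀ ≤ X)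
    (hbase : h (2 * x₀) ≤ 2 * h x₀) :
    ∀ x₁ x₂ : ℝ, x₀ ≤ x₁ → x₀ ≤ x₂ → x₁ + x₂ ≤ X →
      h (x₁ + x₂) ≤ h x₁ + h x₂ := by
  have hanti : AntitoneOn h' (Set.Icc x₀ X) := by
    apply antitoneOn_of_hasDerivWithinAt_nonpos (f' := h'') (convex_Icc x₀ X)
    · exact fun x hx => (hd2 x hx).continuousAt.continuousWithinAt
    · exact fun x hx => (hd2 x (interior_subset hx)).hasDerivWithinAt
    · exact fun x hx => hconc x (interior_subset hx)
  have key : ∀ s t : ℝ, 0 ≤ s → x₀ ≤ t → t + s ≤ X →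
      h (t + s) - h t ≤ h (x₀ + s) - h x₀ := by
    intro s t hs ht hts
    have hder : ∀ x ∈ Set.Icc x₀ t,
        HasDerivAt (fun y => h (y + s) - h y) (h' (x + s) - h' x) x := by
      intro x hx
      have h1 := hd1 (x + s) ⟨by linarith [hx.1], by linarith [hx.2]⟩
      exact (h1.comp_add_const x s).sub (hd1 x ⟨hx.1, by linarith [hx.2]⟩)
    have hA : AntitoneOn (fun y => h (y + s) - h y) (Set.Icc x₀ t) := by
      apply antitoneOn_of_hasDerivWithinAt_nonpos
        (f' := fun x => h' (x + s) - h' x) (convex_Icc x₀ t)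
      · exact fun x hx => (hder x hx).continuousAt.continuousWithinAt
      · exact fun x hx => (hder x (interior_subset hx)).hasDerivWithinAt
      · intro x hx
        have hx' : x ∈ Set.Icc x₀ t := interior_subset hx
        have := hanti (a := x) (b := x + s) ⟨hx'.1, by linarith [hx'.2]⟩
          ⟨by linarith [hx'.1], by linarith [hx'.2]⟩ (by linarith)
        simpa using this
    exact hA (Set.left_mem_Icc.2 ht) (Set.right_mem_Icc.2 ht) ht
  intro x₁ x₂ h₁ h₂ hX
  have e1 := key x₂ x₁ (by linarith) h₁ hX
  have e2 := key x₀ x₂ hx₀.le h₂ (by linarith)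
  rw [← two_mul, add_comm x₂ x₀] at e2
  linarith
end

section
/- Let λ : ℝ^d → ℝ be a seminorm and let h : ℝ → ℝ be nondecreasing on [0,∞) and subadditive on [0,∞). Let m ≥ 1, q_1, …, q_m ∈ ℝ^d, v_1, …, v_m > 0, a_1, …, a_m ∈ ℝ, q = ∑_{j=1}^m a_j·q_j, and v > 0 with ∑_{j=1}^m a_j²·v_j ≤ v. Then h(λ(q)²/v) ≤ ∑_{j=1}^m h(λ(q_j)²/v_j). -/
/-- The central chain inequality in the proof of Theorem 1:
`h(λ(q)²/v) ≤ ∑ⱼ h(λ(qⱼ)²/vⱼ)` for `h` nondecreasing and subadditive on `[0,∞)`. -/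
theorem stmt_8 (d : ℕ)
    (lam : (Fin d → ℝ) → ℝ)
    (hlam_smul : ∀ (c : ℝ) (q : Fin d → ℝ), lam (c • q) = |c| * lam q)
    (hlam_add : ∀ q q' : Fin d → ℝ, lam (q + q') ≤ lam q + lam q')
    (h : ℝ → ℝ)
    (hh_mono : ∀ x y : ℝ, 0 ≤ x → x ≤ y → h x ≤ h y)
    (hh_sub : ∀ x y : ℝ, 0 ≤ x → 0 ≤ y → h (x + y) ≤ h x + h y)
    (m : ℕ) (hm : 1 ≤ m)
    (qs : Fin m → (Fin d → ℝ)) (vs : Fin m → ℝ) (hvs : ∀ j, 0 < vs j)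
    (a : Fin m → ℝ)
    (q : Fin d → ℝ) (hq : q = ∑ j, a j • qs j)
    (v : ℝ) (hv : 0 < v)
    (hvsum : ∑ j, (a j) ^ 2 * vs j ≤ v) :
    h (lam q ^ 2 / v) ≤ ∑ j, h (lam (qs j) ^ 2 / vs j) := by
  have h0 : lam 0 = 0 := by
    have := hlam_smul 0 0
    simpa using this
  have hnn : ∀ x, 0 ≤ lam x := by
    intro x
    have h1 := hlam_add x ((-1 : ℝ) • x)
    have h2 : x + (-1 : ℝ) • x = 0 := by simp
    rw [h2, h0, hlam_smul] at h1
    simp at h1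
    linarith
  have htri : lam q ≤ ∑ j, |a j| * lam (qs j) := by
    rw [hq]
    refine (Finset.le_sum_of_subadditive lam h0.le hlam_add Finset.univ _).trans ?_
    exact Finset.sum_le_sum fun j _ => (hlam_smul _ _).le
  have hterm : ∀ j, 0 ≤ lam (qs j) ^ 2 / vs j := fun j => div_nonneg (sq_nonneg _) (hvs j).le
  have hcs : (∑ j, |a j| * lam (qs j)) ^ 2 ≤
      (∑ j, (a j) ^ 2 * vs j) * ∑ j, lam (qs j) ^ 2 / vs j := by
    apply Finset.sum_sq_le_sum_mul_sum_of_sq_eq_mul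
    · intro j _
      exact mul_nonneg (sq_nonneg _) (hvs j).le
    · intro j _
      exact hterm j
    · intro j _
      have := (hvs j).ne'
      rw [mul_pow, sq_abs]
      field_simp
  have hS : 0 ≤ ∑ j, lam (qs j) ^ 2 / vs j := Finset.sum_nonneg fun j _ => hterm j
  have hmain : lam q ^ 2 / v ≤ ∑ j, lam (qs j) ^ 2 / vs j := by
    rw [div_le_iff₀ hv]
    have h1 := pow_le_pow_left₀ (hnn q) htri 2
    have h2 := mul_le_mul_of_nonneg_right hvsum hS
    linarith
  refine (hh_mono _ _ (div_nonneg (sq_nonneg _) hv.le) hmain).trans ?_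
  have hne : (Finset.univ : Finset (Fin m)).Nonempty := ⟨⟨0, hm⟩, Finset.mem_univ _⟩
  exact Finset.le_sum_nonempty_of_subadditive_on_pred h (fun x => 0 ≤ x)
    hh_sub (fun x y hx hy => add_nonneg hx hy) _ _ hne
    (fun j _ => hterm j)
end

section
/- Let λ : ℝ^d → ℝ be a seminorm. For i = 1,…,n let μ_i, f_i : ℝ → ℝ be nondecreasing on [0,∞), subadditive on [0,∞), with μ_i(0) = f_i(0) = 0. Let 0 < θ_L ≤ θ_U, and let G : ℝ → ℝ be twice differentiable on (0,∞) with G(θ) > 0 and G'(θ) < 0 for all θ > 0, G(θ)·G''(θ) ≤ 2·(G'(θ))² for all θ ∈ [θ_L, θ_U], and G(θ + θ_L) ≤ 1/(1/G(θ_L) + 1/G(θ)) for all θ ∈ [θ_L, θ_U − θ_L]. Define Π(q, θ) = ∑_{i=1}^n μ_i(f_i(θ)). Then for every θ ∈ [θ_L, θ_U], every m ≥ 1, every q, q_1, …, q_m ∈ ℝ^d with λ(q) > 0 and λ(q_j) > 0 for all j, every θ_1, …, θ_m ≥ θ_L with ∑_{j=1}^m θ_j ≤ θ_U, and every a_1,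 …, a_m ∈ ℝ such that ∑_{j=1}^m a_j·q_j = q and ∑_{j=1}^m a_j²·λ(q_j)²·G(θ_j) ≤ λ(q)²·G(θ), one has Π(q, θ) ≤ ∑_{j=1}^m Π(q_j, θ_j). -/
theorem aux_superadd_s9 (θL θU : ℝ) (hL : 0 < θL)
    (G G' G'' : ℝ → ℝ)
    (hGd1 : ∀ θ : ℝ, 0 < θ → HasDerivAt G (G' θ) θ)
    (hGd2 : ∀ θ : ℝ, 0 < θ → HasDerivAt G' (G'' θ) θ)
    (hG_pos : ∀ θ : ℝ, 0 < θ → 0 < G θ)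
    (hG_ineq : ∀ θ ∈ Set.Icc θL θU, G θ * G'' θ ≤ 2 * (G' θ) ^ 2)
    (hG_base : ∀ θ ∈ Set.Icc θL (θU - θL),
      G (θ + θL) ≤ 1 / (1 / G θL + 1 / G θ))
    (x y : ℝ) (hx : θL ≤ x) (hy : θL ≤ y) (hxy : x + y ≤ θU) :
    (G x)⁻¹ + (G y)⁻¹ ≤ (G (x + y))⁻¹ := by
  have hconv : ConvexOn ℝ (Set.Icc θL θU) (fun t => (G t)⁻¹) := by
    have hd1 : ∀ t, 0 < t → HasDerivAt (fun t => (G t)⁻¹) (-G' t / (G t) ^ 2) t :=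
      fun t ht => (hGd1 t ht).fun_inv (hG_pos t ht).ne'
    have hd2 : ∀ t, 0 < t → HasDerivAt (fun t => -G' t / (G t) ^ 2)
        ((2 * (G' t) ^ 2 - G t * G'' t) / (G t) ^ 3) t := by
      intro t ht
      have hp := hG_pos t ht
      have h := ((hGd2 t ht).fun_neg).fun_div ((hGd1 t ht).fun_pow 2) (pow_pos hp 2).ne'
      refine h.congr_deriv ?_
      field_simp
      ring
    refine convexOn_of_hasDerivWithinAt2_nonneg (convex_Icc _ _)
      (f' := fun t => -G' t / (G t) ^ 2)
      (f'' := fun t => (2 * (G' t) ^ 2 - G t * G'' t) / (G t) ^ 3) ?_ ?_ ?_ ?_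
    · intro t ht
      exact (hd1 t (hL.trans_le ht.1)).continuousAt.continuousWithinAt
    · intro t ht
      exact (hd1 t (hL.trans_le (interior_subset ht).1)).hasDerivWithinAt
    · intro t ht
      exact (hd2 t (hL.trans_le (interior_subset ht).1)).hasDerivWithinAt
    · intro t ht
      have ht' := interior_subset ht
      have hp := hG_pos t (hL.trans_le ht'.1)
      have := hG_ineq t ht'
      exact div_nonneg (by linarith) (by positivity)
  have hb : (G θL)⁻¹ + (G y)⁻¹ ≤ (G (y + θL))⁻¹ := by
    have h := hG_base y ⟨hy, by linarith⟩
    have h1 := hG_pos θL hL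
    have h2 := hG_pos y (by linarith)
    have h3 := hG_pos (y + θL) (by linarith)
    rw [one_div, one_div, one_div] at h
    exact (le_inv_comm₀ h3 (by positivity)).1 h
  have hD : 0 < x + y - θL := by linarith
  have hLm : θL ∈ Set.Icc θL θU := ⟨le_rfl, by linarith⟩
  have hSm : x + y ∈ Set.Icc θL θU := ⟨by linarith, hxy⟩
  have ht0 : 0 ≤ (x - θL) / (x + y - θL) := div_nonneg (by linarith) hD.le
  have hs0 : 0 ≤ y / (x + y - θL) := div_nonneg (by linarith) hD.le
  have hst : y / (x + y - θL) + (x - θL) / (x + y - θL) = 1 := by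
    field_simp
    ring
  have c1 := hconv.2 hLm hSm hs0 ht0 hst
  have c2 := hconv.2 hLm hSm ht0 hs0 (by linarith)
  simp only [smul_eq_mul] at c1 c2
  set t := (x - θL) / (x + y - θL) with ht
  have hs : y / (x + y - θL) = 1 - t := by linarith
  have htD : t * (x + y - θL) = x - θL := by rw [ht]; field_simp
  rw [hs] at c1 c2
  have e1 : (1 - t) * θL + t * (x + y) = x := by linarith
  have e2 : t * θL + (1 - t) * (x + y) = y + θL := by linarith
  rw [e1] at c1
  rw [e2] at c2
  linarith

theorem aux_sum_superadd {ι : Type*} (H : ℝ → ℝ) (θL θU : ℝ) (hL : 0 < θL)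
    (hH : ∀ x y, θL ≤ x → θL ≤ y → x + y ≤ θU → H x + H y ≤ H (x + y))
    (θs : ι → ℝ) (hθs : ∀ j, θL ≤ θs j) (s : Finset ι) (hs : s.Nonempty) :
    ∑ j ∈ s, θs j ≤ θU →
      θL ≤ ∑ j ∈ s, θs j ∧ ∑ j ∈ s, H (θs j) ≤ H (∑ j ∈ s, θs j) := by
  induction hs using Finset.Nonempty.cons_induction with
  | singleton b => intro _; simpa using hθs b
  | cons b s hb hs ih =>
    intro h
    rw [Finset.sum_cons] at h
    have hbL := hθs b
    obtain ⟨h1, h2⟩ := ih (by linarith)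
    rw [Finset.sum_cons, Finset.sum_cons]
    exact ⟨by linarith, by linarith [hH _ _ hbL h1 h]⟩

theorem aux_sub_sum {ι : Type*} (g : ℝ → ℝ) (h0 : g 0 = 0)
    (hsub : ∀ x y : ℝ, 0 ≤ x → 0 ≤ y → g (x + y) ≤ g x + g y)
    (s : Finset ι) (u : ι → ℝ) (hu : ∀ j, 0 ≤ u j) :
    g (∑ j ∈ s, u j) ≤ ∑ j ∈ s, g (u j) := by
  induction s using Finset.cons_induction with
  | empty => simp [h0]
  | cons b s hb ih =>
    rw [Finset.sum_cons, Finset.sum_cons]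
    have := hsub (u b) (∑ j ∈ s, u j) (hu b) (Finset.sum_nonneg fun j _ => hu j)
    linarith

/-- Theorem 2 of the paper (partial arbitrage freeness): with utility
`v = λ(q)²·G(θ)` and price `∑ i, μ i (f i θ)`, arbitrage by linear combination is
impossible when all purchased queries have parameters `θⱼ ≥ θL` with total `≤ θU`. -/
theorem stmt_9 (d n : ℕ)
    (lam : (Fin d → ℝ) → ℝ)
    (hlam_smul : ∀ (c : ℝ) (q : Fin d → ℝ), lam (c • q) = |c| * lam q)
    (hlam_add : ∀ q q' : Fin d → ℝ, lam (q + q') ≤ lam q + lam q')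
    (μ f : Fin n → ℝ → ℝ)
    (hμ_mono : ∀ i, ∀ x y : ℝ, 0 ≤ x → x ≤ y → μ i x ≤ μ i y)
    (hμ_sub : ∀ i, ∀ x y : ℝ, 0 ≤ x → 0 ≤ y → μ i (x + y) ≤ μ i x + μ i y)
    (hμ0 : ∀ i, μ i 0 = 0)
    (hf_mono : ∀ i, ∀ x y : ℝ, 0 ≤ x → x ≤ y → f i x ≤ f i y)
    (hf_sub : ∀ i, ∀ x y : ℝ, 0 ≤ x → 0 ≤ y → f i (x + y) ≤ f i x + f i y)
    (hf0 : ∀ i, f i 0 = 0)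
    (θL θU : ℝ) (hL : 0 < θL) (hLU : θL ≤ θU)
    (G G' G'' : ℝ → ℝ)
    (hGd1 : ∀ θ : ℝ, 0 < θ → HasDerivAt G (G' θ) θ)
    (hGd2 : ∀ θ : ℝ, 0 < θ → HasDerivAt G' (G'' θ) θ)
    (hG_pos : ∀ θ : ℝ, 0 < θ → 0 < G θ)
    (hG'_neg : ∀ θ : ℝ, 0 < θ → G' θ < 0)
    (hG_ineq : ∀ θ ∈ Set.Icc θL θU, G θ * G'' θ ≤ 2 * (G' θ) ^ 2)
    (hG_base : ∀ θ ∈ Set.Icc θL (θU - θL),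
      G (θ + θL) ≤ 1 / (1 / G θL + 1 / G θ))
    (price : (Fin d → ℝ) → ℝ → ℝ)
    (hprice : ∀ (q : Fin d → ℝ) (θ : ℝ), price q θ = ∑ i, μ i (f i θ))
    (θ : ℝ) (hθ : θ ∈ Set.Icc θL θU)
    (m : ℕ) (hm : 1 ≤ m)
    (q : Fin d → ℝ) (hq_pos : 0 < lam q)
    (qs : Fin m → (Fin d → ℝ)) (hqs_pos : ∀ j, 0 < lam (qs j))
    (θs : Fin m → ℝ) (hθs : ∀ j, θL ≤ θs j) (hθsum : ∑ j, θs j ≤ θU)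
    (a : Fin m → ℝ)
    (hq : ∑ j, a j • qs j = q)
    (hvsum : ∑ j, (a j) ^ 2 * (lam (qs j) ^ 2 * G (θs j)) ≤ lam q ^ 2 * G θ) :
    price q θ ≤ ∑ j, price (qs j) (θs j) := by
  have hθ0 : 0 < θ := hL.trans_le hθ.1
  have hs0 : ∀ j, 0 < θs j := fun j => hL.trans_le (hθs j)
  have hne : (Finset.univ : Finset (Fin m)).Nonempty := ⟨⟨0, hm⟩, Finset.mem_univ _⟩
  obtain ⟨hSL, hSH⟩ := aux_sum_superadd (fun t => (G t)⁻¹) θL θU hL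
    (aux_superadd_s9 θL θU hL G G' G'' hGd1 hGd2 hG_pos hG_ineq hG_base)
    θs hθs Finset.univ hne hθsum
  set S := ∑ j, θs j with hS
  have hS0 : 0 < S := hL.trans_le hSL
  have hlam0 : lam 0 = 0 := by simpa using hlam_smul 0 0
  have hl : lam q ≤ ∑ j, |a j| * lam (qs j) := by
    have := Finset.le_sum_of_subadditive lam hlam0.le hlam_add Finset.univ
      (fun j => a j • qs j)
    simp only [hlam_smul] at this
    rwa [hq] at this
  have hCS : (∑ j, |a j| * lam (qs j)) ^ 2 ≤
      (∑ j, (a j) ^ 2 * (lam (qs j) ^ 2 * G (θs j))) * ∑ j, (G (θs j))⁻¹ := by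
    refine Finset.sum_sq_le_sum_mul_sum_of_sq_eq_mul _ ?_ ?_ ?_
    · intro j _
      have := hG_pos _ (hs0 j)
      positivity
    · intro j _
      have := hG_pos _ (hs0 j)
      positivity
    · intro j _
      have := hG_pos _ (hs0 j)
      rw [mul_pow, sq_abs]
      field_simp
  have hGθ := hG_pos θ hθ0
  have hGS := hG_pos S hS0
  have hkey : lam q ^ 2 ≤ lam q ^ 2 * (G θ * (G S)⁻¹) := by
    calc lam q ^ 2 ≤ (∑ j, |a j| * lam (qs j)) ^ 2 := by gcongr
      _ ≤ _ := hCS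
      _ ≤ (lam q ^ 2 * G θ) * (G S)⁻¹ := by
        refine mul_le_mul hvsum hSH ?_ (by positivity)
        exact Finset.sum_nonneg fun j _ => (inv_pos.2 (hG_pos _ (hs0 j))).le
      _ = _ := by ring
  have hone : 1 ≤ G θ * (G S)⁻¹ := by
    have : 0 < lam q ^ 2 := by positivity
    exact le_of_mul_le_mul_left (by linarith) this
  have hGle : G S ≤ G θ := by
    rwa [← div_eq_mul_inv, one_le_div hGS] at hone
  have hanti : StrictAntiOn G (Set.Ioi 0) := by
    refine strictAntiOn_of_deriv_neg (convex_Ioi 0)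
      (fun t ht => (hGd1 t ht).continuousAt.continuousWithinAt) ?_
    intro t ht
    have ht' : 0 < t := interior_subset ht
    rw [(hGd1 t ht').deriv]
    exact hG'_neg t ht'
  have hle : θ ≤ S := (hanti.le_iff_ge hS0 hθ0).1 hGle
  simp only [hprice]
  rw [Finset.sum_comm]
  refine Finset.sum_le_sum fun i _ => ?_
  have hfn : ∀ t, 0 ≤ t → 0 ≤ f i t := fun t ht => by
    simpa [hf0] using hf_mono i 0 t le_rfl ht
  calc μ i (f i θ) ≤ μ i (∑ j, f i (θs j)) := by
        refine hμ_mono i _ _ (hfn θ hθ0.le) ((hf_mono i _ _ hθ0.le hle).trans ?_)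
        exact aux_sub_sum (f i) (hf0 i) (hf_sub i) Finset.univ θs fun j => (hs0 j).le
    _ ≤ _ := aux_sub_sum (μ i) (hμ0 i) (hμ_sub i) Finset.univ _ fun j => hfn _ (hs0 j).le
end

section
/- Let λ : ℝ^d → ℝ be a seminorm, let 0 < x_L ≤ x_U, and for i = 1,…,n let h_i : ℝ → ℝ be nondecreasing on [0, x_U] and satisfy: for all x₁, x₂ ≥ x_L with x₁ + x₂ ≤ x_U, h_i(x₁ + x₂) ≤ h_i(x₁) + h_i(x₂). Let m ≥ 1, q, q_1, …, q_m ∈ ℝ^d, v, v_1, …, v_m > 0 and a_1, …, a_m ∈ ℝ be such that λ(q_j)²/v_j ∈ [x_L, x_U] for each j, ∑_{j=1}^m λ(q_j)²/v_j ≤ x_U, ∑_{j=1}^m a_j·q_j = q, ∑_{j=1}^m a_j²·v_j ≤ v, and λ(q)²/v ≤ x_U. Then ∑_{i=1}^n h_i(λ(q)²/v) ≤ ∑_{j=1}^m ∑_{i=1}^n h_i(λ(q_j)²/v_j). -/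
theorem sub_aux {ι : Type*} (f : ℝ → ℝ) (xL xU : ℝ) (hxL : 0 < xL)
    (hsub : ∀ x₁ x₂ : ℝ, xL ≤ x₁ → xL ≤ x₂ → x₁ + x₂ ≤ xU → f (x₁ + x₂) ≤ f x₁ + f x₂)
    (x : ι → ℝ) (hx : ∀ j, xL ≤ x j) (s : Finset ι) (hs : s.Nonempty) :
    xL ≤ ∑ j ∈ s, x j ∧ (∑ j ∈ s, x j ≤ xU → f (∑ j ∈ s, x j) ≤ ∑ j ∈ s, f (x j)) := by
  induction hs using Finset.Nonempty.cons_induction with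
  | singleton a => simpa using hx a
  | cons a s ha hs ih =>
    obtain ⟨h1, h2⟩ := ih
    rw [Finset.sum_cons, Finset.sum_cons]
    have h3 := hx a
    refine ⟨by linarith, fun hU => ?_⟩
    have h4 := hsub _ _ h3 h1 hU
    have h5 := h2 (by linarith)
    linarith

/-- Assembly step of Theorems 2 and 3: monotone, constrained-subadditive
micro-payments applied to the normalized inverse variance yield a
partially arbitrage-free total price. -/
theorem stmt_10 (d n : ℕ)
    (lam : (Fin d → ℝ) → ℝ)
    (hlam_smul : ∀ (c : ℝ) (q : Fin d → ℝ), lam (c • q) = |c| * lam q)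
    (hlam_add : ∀ q q' : Fin d → ℝ, lam (q + q') ≤ lam q + lam q')
    (xL xU : ℝ) (hxL : 0 < xL) (hxLU : xL ≤ xU)
    (h : Fin n → ℝ → ℝ)
    (hh_mono : ∀ i, ∀ x y : ℝ, 0 ≤ x → x ≤ y → y ≤ xU → h i x ≤ h i y)
    (hh_sub : ∀ i, ∀ x₁ x₂ : ℝ, xL ≤ x₁ → xL ≤ x₂ → x₁ + x₂ ≤ xU →
      h i (x₁ + x₂) ≤ h i x₁ + h i x₂)
    (m : ℕ) (hm : 1 ≤ m)
    (q : Fin d → ℝ) (qs : Fin m → (Fin d → ℝ))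
    (v : ℝ) (vs : Fin m → ℝ) (hv : 0 < v) (hvs : ∀ j, 0 < vs j)
    (a : Fin m → ℝ)
    (hrange : ∀ j, lam (qs j) ^ 2 / vs j ∈ Set.Icc xL xU)
    (hsum_range : ∑ j, lam (qs j) ^ 2 / vs j ≤ xU)
    (hq : ∑ j, a j • qs j = q)
    (hvsum : ∑ j, (a j) ^ 2 * vs j ≤ v)
    (hq_range : lam q ^ 2 / v ≤ xU) :
    ∑ i, h i (lam q ^ 2 / v) ≤ ∑ j, ∑ i, h i (lam (qs j) ^ 2 / vs j) := by
  have h0 : lam 0 = 0 := by simpa using hlam_smul 0 0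
  have hnn : ∀ p, 0 ≤ lam p := by
    intro p
    have h1 := hlam_add p ((-1 : ℝ) • p)
    rw [hlam_smul] at h1
    simp [h0] at h1
    linarith
  have htri : lam q ≤ ∑ j, |a j| * lam (qs j) := by
    rw [← hq]
    refine (Finset.le_sum_of_subadditive lam h0.le hlam_add _ _).trans ?_
    simp [hlam_smul]
  have hxs : ∀ j, 0 ≤ lam (qs j) ^ 2 / vs j := fun j => hxL.le.trans (hrange j).1
  have hcs : (∑ j, |a j| * lam (qs j)) ^ 2 ≤
      (∑ j, lam (qs j) ^ 2 / vs j) * (∑ j, (a j) ^ 2 * vs j) := by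
    apply Finset.sum_sq_le_sum_mul_sum_of_sq_eq_mul
    · intro j _
      exact hxs j
    · intro j _
      have := hvs j
      positivity
    · intro j _
      have := (hvs j).ne'
      rw [mul_pow, sq_abs]
      field_simp
  have hle : lam q ^ 2 / v ≤ ∑ j, lam (qs j) ^ 2 / vs j := by
    rw [div_le_iff₀ hv]
    calc lam q ^ 2 ≤ (∑ j, |a j| * lam (qs j)) ^ 2 := pow_le_pow_left₀ (hnn q) htri 2
      _ ≤ _ := hcs
      _ ≤ _ := mul_le_mul_of_nonneg_left hvsum (Finset.sum_nonneg fun j _ => hxs j)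
  rw [Finset.sum_comm]
  refine Finset.sum_le_sum fun i _ => ?_
  refine (hh_mono i _ _ (by positivity) hle hsum_range).trans ?_
  exact (sub_aux (h i) xL xU hxL (hh_sub i) (fun j => lam (qs j) ^ 2 / vs j)
    (fun j => (hrange j).1) Finset.univ ⟨⟨0, hm⟩, Finset.mem_univ _⟩).2 hsum_range
end

section
/- Let a < b and let P : ℝ → ℝ be twice differentiable on (a, b) with P(θ) > 0, P'(θ) < 0 and P(θ)·P''(θ) ≤ 2·(P'(θ))² for all θ ∈ (a, b). Let J ⊆ (0,∞) be an open interval and let h : ℝ → ℝ be twice differentiable on J with h(x) ∈ (a, b) and P(h(x)) = 1/x for all x ∈ J. Then h''(x) ≤ 0 for all x ∈ J. -/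
/-- Core concavity computation: if `P` satisfies `P > 0`, `P' < 0` and
`P·P'' ≤ 2(P')²` on `(a,b)`, and `h` maps an open interval `J ⊆ (0,∞)` into
`(a,b)` with `P(h(x)) = 1/x`, then `h'' ≤ 0` on `J`. -/
theorem stmt_11 (a b : ℝ) (hab : a < b)
    (P P' P'' : ℝ → ℝ)
    (hPd1 : ∀ θ ∈ Set.Ioo a b, HasDerivAt P (P' θ) θ)
    (hPd2 : ∀ θ ∈ Set.Ioo a b, HasDerivAt P' (P'' θ) θ)
    (hP_pos : ∀ θ ∈ Set.Ioo a b, 0 < P θ)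
    (hP'_neg : ∀ θ ∈ Set.Ioo a b, P' θ < 0)
    (hP_ineq : ∀ θ ∈ Set.Ioo a b, P θ * P'' θ ≤ 2 * (P' θ) ^ 2)
    (c e : ℝ) (hJ : Set.Ioo c e ⊆ Set.Ioi (0 : ℝ))
    (h h' h'' : ℝ → ℝ)
    (hhd1 : ∀ x ∈ Set.Ioo c e, HasDerivAt h (h' x) x)
    (hhd2 : ∀ x ∈ Set.Ioo c e, HasDerivAt h' (h'' x) x)
    (hmem : ∀ x ∈ Set.Ioo c e, h x ∈ Set.Ioo a b)
    (hinv : ∀ x ∈ Set.Ioo c e, P (h x) = 1 / x) :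
    ∀ x ∈ Set.Ioo c e, h'' x ≤ 0 := by
  have E1 : ∀ x ∈ Set.Ioo c e, P' (h x) * h' x = -(P (h x)) ^ 2 := by
    intro x hx
    have hx0 : x ≠ 0 := ne_of_gt (hJ hx)
    have d1 : HasDerivAt (fun y => P (h y)) (P' (h x) * h' x) x :=
      (hPd1 _ (hmem x hx)).comp x (hhd1 x hx)
    have d2 : HasDerivAt (fun y => P (h y)) (-(x ^ 2)⁻¹) x := by
      refine (hasDerivAt_inv hx0).congr_of_eventuallyEq ?_
      filter_upwards [isOpen_Ioo.mem_nhds hx] with y hy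
      rw [hinv y hy, one_div]
    rw [d1.unique d2, hinv x hx, one_div, inv_pow]
  intro x hx
  have d1 : HasDerivAt (fun y => P (h y)) (P' (h x) * h' x) x :=
    (hPd1 _ (hmem x hx)).comp x (hhd1 x hx)
  have d2 : HasDerivAt (fun y => P' (h y)) (P'' (h x) * h' x) x :=
    (hPd2 _ (hmem x hx)).comp x (hhd1 x hx)
  have d3 := d2.fun_mul (hhd2 x hx)
  have d4 : HasDerivAt (fun y => P' (h y) * h' y)
      (-(2 * P (h x) * (P' (h x) * h' x))) x := by
    have d5 := (d1.fun_pow 2).fun_neg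
    refine (d5.congr_of_eventuallyEq ?_).congr_deriv (by norm_num)
    filter_upwards [isOpen_Ioo.mem_nhds hx] with y hy
    exact E1 y hy
  have E2 := d3.unique d4
  have e1 := E1 x hx
  have hp := hP_pos _ (hmem x hx)
  have hq := hP'_neg _ (hmem x hx)
  have hi := hP_ineq _ (hmem x hx)
  generalize P (h x) = p at *
  generalize P' (h x) = q at *
  generalize P'' (h x) = r at *
  have key : q ^ 3 * h'' x = p ^ 3 * (2 * q ^ 2 - p * r) := by
    linear_combination q ^ 2 * E2 - (r * (q * h' x - p ^ 2) + 2 * p * q ^ 2) * e1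
  by_contra hc
  push Not at hc
  have h3 : q ^ 3 < 0 := by
    have := mul_pos_of_neg_of_neg hq hq
    nlinarith
  have : q ^ 3 * h'' x < 0 := mul_neg_of_neg_of_pos h3 hc
  have : 0 ≤ p ^ 3 * (2 * q ^ 2 - p * r) := mul_nonneg (by positivity) (by linarith)
  linarith
end

section
/- For q ∈ ℝ^d define Δq = max_{1≤l≤d} q_l − min_{1≤l≤d} q_l. For i = 1,…,n let μ_i : ℝ → ℝ be nondecreasing on [0,∞), subadditive on [0,∞), with μ_i(0) = 0. Define Π(q, v) = ∑_{i=1}^n μ_i(Δq·√(2/v)) for v > 0. Then Π is arbitrage free: for every m ≥ 1, every q, q_1, …, q_m ∈ ℝ^d, every v, v_1, …, v_m > 0 and every a_1, …, a_m ∈ ℝ with ∑_{j=1}^m a_j·q_j = q and ∑_{j=1}^m a_j²·v_j ≤ v, one has Π(q, v) ≤ ∑_{j=1}^m Π(q_j, v_j). -/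
/-- Corollary of Theorem 1: the UniformTrading pricing function
`Π(q,v) = ∑ i, μ i (Δq·√(2/v))` is arbitrage free, where
`Δq = max_l q_l − min_l q_l` is the global sensitivity. -/
theorem stmt_14 (d n : ℕ) (hd : 1 ≤ d)
    (Δ : (Fin d → ℝ) → ℝ)
    (hΔ : ∀ q : Fin d → ℝ, Δ q = (⨆ l, q l) - (⨅ l, q l))
    (μ : Fin n → ℝ → ℝ)
    (hμ_mono : ∀ i, ∀ x y : ℝ, 0 ≤ x → x ≤ y → μ i x ≤ μ i y)
    (hμ_sub : ∀ i, ∀ x y : ℝ, 0 ≤ x → 0 ≤ y → μ i (x + y) ≤ μ i x + μ i y)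
    (hμ0 : ∀ i, μ i 0 = 0)
    (price : (Fin d → ℝ) → ℝ → ℝ)
    (hprice : ∀ (q : Fin d → ℝ) (v : ℝ), 0 < v →
      price q v = ∑ i, μ i (Δ q * Real.sqrt (2 / v)))
    (m : ℕ) (hm : 1 ≤ m)
    (q : Fin d → ℝ) (qs : Fin m → (Fin d → ℝ))
    (v : ℝ) (vs : Fin m → ℝ) (hv : 0 < v) (hvs : ∀ j, 0 < vs j)
    (a : Fin m → ℝ)
    (hq : ∑ j, a j • qs j = q)
    (hvsum : ∑ j, (a j) ^ 2 * vs j ≤ v) :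
    price q v ≤ ∑ j, price (qs j) (vs j) := by
  haveI : Nonempty (Fin d) := ⟨⟨0, hd⟩⟩
  have hle : ∀ (p : Fin d → ℝ) (l k : Fin d), p l - p k ≤ Δ p := by
    intro p l k
    rw [hΔ]
    have h1 : p l ≤ ⨆ l, p l := le_ciSup (Set.finite_range p).bddAbove l
    have h2 : (⨅ l, p l) ≤ p k := ciInf_le (Set.finite_range p).bddBelow k
    linarith
  have hmax : ∀ (p : Fin d → ℝ), ∃ l k, Δ p = p l - p k := by
    intro p
    obtain ⟨l, hl⟩ := exists_eq_ciSup_of_finite (f := p)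
    obtain ⟨k, hk⟩ := exists_eq_ciInf_of_finite (f := p)
    exact ⟨l, k, by rw [hΔ, hl, hk]⟩
  have hnn : ∀ p : Fin d → ℝ, 0 ≤ Δ p := by
    intro p
    have := hle p ⟨0, hd⟩ ⟨0, hd⟩
    linarith
  have hΔq : Δ q ≤ ∑ j, |a j| * Δ (qs j) := by
    obtain ⟨l, k, h⟩ := hmax q
    rw [h, ← hq, Finset.sum_apply, Finset.sum_apply, ← Finset.sum_sub_distrib]
    refine Finset.sum_le_sum fun j _ => ?_
    simp only [Pi.smul_apply, smul_eq_mul]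
    rw [← mul_sub]
    calc a j * (qs j l - qs j k) ≤ |a j * (qs j l - qs j k)| := le_abs_self _
      _ = |a j| * |qs j l - qs j k| := abs_mul _ _
      _ ≤ |a j| * Δ (qs j) := by
        refine mul_le_mul_of_nonneg_left (abs_le.2 ⟨?_, hle _ _ _⟩) (abs_nonneg _)
        have := hle (qs j) k l
        linarith
  have hs : ∀ j, |a j| * Real.sqrt (2 / v) ≤ Real.sqrt (2 / vs j) := by
    intro j
    have h1 : a j ^ 2 * vs j ≤ v := le_trans
      (Finset.single_le_sum (f := fun j => a j ^ 2 * vs j)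
        (fun j _ => mul_nonneg (sq_nonneg _) (hvs j).le) (Finset.mem_univ j)) hvsum
    rw [← Real.sqrt_sq_eq_abs, ← Real.sqrt_mul (sq_nonneg _)]
    apply Real.sqrt_le_sqrt
    rw [← mul_div_assoc, div_le_div_iff₀ hv (hvs j)]
    linarith
  have hx : Δ q * Real.sqrt (2 / v) ≤ ∑ j, Δ (qs j) * Real.sqrt (2 / vs j) := by
    refine (mul_le_mul_of_nonneg_right hΔq (Real.sqrt_nonneg _)).trans ?_
    rw [Finset.sum_mul]
    refine Finset.sum_le_sum fun j _ => ?_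
    have := mul_le_mul_of_nonneg_left (hs j) (hnn (qs j))
    linarith
  have hsub : ∀ i (x : Fin m → ℝ), (∀ j, 0 ≤ x j) → ∀ s : Finset (Fin m),
      μ i (∑ j ∈ s, x j) ≤ ∑ j ∈ s, μ i (x j) := by
    intro i x hx s
    induction s using Finset.induction_on with
    | empty => simp [hμ0]
    | insert b s hb ih =>
      rw [Finset.sum_insert hb, Finset.sum_insert hb]
      have := hμ_sub i (x b) (∑ j ∈ s, x j) (hx b) (Finset.sum_nonneg fun j _ => hx j)
      linarith
  rw [hprice q v hv, Finset.sum_congr rfl fun j _ => hprice (qs j) (vs j) (hvs j),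
    Finset.sum_comm]
  refine Finset.sum_le_sum fun i _ => ?_
  exact (hμ_mono i _ _ (mul_nonneg (hnn q) (Real.sqrt_nonneg _)) hx).trans
    (hsub i _ (fun j => mul_nonneg (hnn _) (Real.sqrt_nonneg _)) Finset.univ)
end

section
/- For q ∈ ℝ^d define Δq = max_{1≤l≤d} q_l − min_{1≤l≤d} q_l. Let 0 < θ_L ≤ θ_U. For i = 1,…,n let μ_i : ℝ → ℝ be nondecreasing, twice differentiable on (0,∞), with μ_i(0) = 0, and suppose: (1) μ_i(√2·θ_L) ≤ 2·μ_i(θ_L), and (2) for all θ ∈ [θ_L, θ_U], θ·μ_i''(θ) ≤ μ_i'(θ). Define Π(q, v) = ∑_{i=1}^n μ_i(Δq·√(2/v)) for v > 0. Then Π is partially arbitrage free for v ∈ [2(Δq/θ_U)², 2(Δq/θ_L)²]: for every m ≥ 1, every q, q_1, …, q_m ∈ ℝ^d with Δq > 0 and Δq_j > 0 for all j, every v ∈ [2(Δq/θ_U)², 2(Δq/θ_L)²] and v_j = 2(Δq_j/θ_j)² with θ_j ∈ [θ_L, θ_U] and ∑_{j=1}^m θ_j ≤ θ_U, and every a_1,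 …, a_m ∈ ℝ with ∑_{j=1}^m a_j·q_j = q and ∑_{j=1}^m a_j²·v_j ≤ v, one has Π(q, v) ≤ ∑_{j=1}^m Π(q_j, v_j). -/
lemma aux_shift (g g' : ℝ → ℝ) (L U : ℝ) (hL : 0 < L)
    (hg : ∀ x, 0 < x → HasDerivAt g (g' x) x) (hanti : AntitoneOn g' (Set.Icc L U))
    (s x y : ℝ) (hs : 0 ≤ s) (hx : L ≤ x) (hxy : x ≤ y) (hy : y + s ≤ U) :
    g (y + s) - g y ≤ g (x + s) - g x := by
  have hd : ∀ z ∈ Set.Icc x y, HasDerivAt (fun z => g (z + s) - g z) (g' (z + s) - g' z) z := by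
    intro z hz
    have h1 : HasDerivAt (fun z => g (z + s)) (g' (z + s)) z :=
      (hg (z + s) (by linarith [hz.1])).comp_add_const z s
    exact h1.sub (hg z (by linarith [hz.1]))
  have := antitoneOn_of_deriv_nonpos (convex_Icc x y)
    (fun z hz => (hd z hz).continuousAt.continuousWithinAt)
    (fun z hz => (hd z (interior_subset hz)).differentiableAt.differentiableWithinAt)
    (fun z hz => by
      have hz' := interior_subset hz
      rw [(hd z hz').deriv]
      have := hanti (a := z) (b := z + s) ⟨by linarith [hz'.1], by linarith [hz'.2]⟩
        ⟨by linarith [hz'.1], by linarith [hz'.2]⟩ (by linarith)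
      linarith)
  exact this (Set.left_mem_Icc.2 hxy) (Set.right_mem_Icc.2 hxy) hxy

lemma aux_sub2 (g g' : ℝ → ℝ) (L U : ℝ) (hL : 0 < L)
    (hg : ∀ x, 0 < x → HasDerivAt g (g' x) x) (hanti : AntitoneOn g' (Set.Icc L U))
    (hb : g (L + L) ≤ 2 * g L)
    (x y : ℝ) (hx : L ≤ x) (hy : L ≤ y) (hxy : x + y ≤ U) : g (x + y) ≤ g x + g y := by
  have h1 := aux_shift g g' L U hL hg hanti x L y (by linarith) le_rfl hy (by linarith)
  have h2 := aux_shift g g' L U hL hg hanti L L x (by linarith) le_rfl hx (by linarith)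
  rw [add_comm y x, add_comm L x] at h1
  linarith

lemma aux_sum_s15 (g g' : ℝ → ℝ) (L U : ℝ) (hL : 0 < L)
    (hg : ∀ x, 0 < x → HasDerivAt g (g' x) x) (hanti : AntitoneOn g' (Set.Icc L U))
    (hb : g (L + L) ≤ 2 * g L) {ι : Type*} (x : ι → ℝ) (hx : ∀ j, L ≤ x j)
    (s : Finset ι) (hs : s.Nonempty) :
    (∑ j ∈ s, x j ≤ U → g (∑ j ∈ s, x j) ≤ ∑ j ∈ s, g (x j)) ∧ L ≤ ∑ j ∈ s, x j := by
  induction hs using Finset.Nonempty.cons_induction with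
  | singleton a => simp [hx a]
  | cons a s ha hs ih =>
    rw [Finset.sum_cons, Finset.sum_cons]
    refine ⟨fun h => ?_, by linarith [hx a, ih.2]⟩
    have := aux_sub2 g g' L U hL hg hanti hb (x a) _ (hx a) ih.2 h
    linarith [ih.1 (by linarith [hx a])]

lemma aux_mu (f f' f'' : ℝ → ℝ) (θL θU : ℝ) (hL : 0 < θL)
    (h1 : ∀ θ : ℝ, 0 < θ → HasDerivAt f (f' θ) θ)
    (h2 : ∀ θ : ℝ, 0 < θ → HasDerivAt f' (f'' θ) θ)
    (hb : f (Real.sqrt 2 * θL) ≤ 2 * f θL)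
    (hi : ∀ θ ∈ Set.Icc θL θU, θ * f'' θ ≤ f' θ)
    (m : ℕ) (hm : 1 ≤ m) (t : Fin m → ℝ) (ht : ∀ j, θL ≤ t j) 
    (hsum : ∑ j, t j ^ 2 ≤ θU ^ 2) (hLU : θL ≤ θU) :
    f (Real.sqrt (∑ j, t j ^ 2)) ≤ ∑ j, f (t j) := by
  have hh : AntitoneOn (fun θ => f' θ / θ) (Set.Icc θL θU) := by
    have hd : ∀ z ∈ Set.Icc θL θU, HasDerivAt (fun θ => f' θ / θ)
        ((f'' z * z - f' z * 1) / z ^ 2) z := by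
      intro z hz
      have hz0 : 0 < z := by linarith [hz.1]
      exact (h2 z hz0).div (hasDerivAt_id z) hz0.ne'
    refine antitoneOn_of_deriv_nonpos (convex_Icc _ _)
      (fun z hz => (hd z hz).continuousAt.continuousWithinAt)
      (fun z hz => (hd z (interior_subset hz)).differentiableAt.differentiableWithinAt)
      (fun z hz => ?_)
    have hz' := interior_subset hz
    rw [(hd z hz').deriv]
    apply div_nonpos_of_nonpos_of_nonneg _ (sq_nonneg z)
    linarith [hi z hz']
  haveI : Nonempty (Fin m) := ⟨⟨0, hm⟩⟩
  have hg : ∀ x, 0 < x → HasDerivAt (fun x => f (√x)) (f' (√x) / √x / 2) x := by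
    intro x hx
    have := (h1 (√x) (Real.sqrt_pos.2 hx)).comp x (Real.hasDerivAt_sqrt hx.ne')
    rw [mul_one_div, mul_comm 2, ← div_div] at this
    exact this
  have hanti : AntitoneOn (fun x => f' (√x) / √x / 2) (Set.Icc (θL ^ 2) (θU ^ 2)) := by
    have hmem : ∀ x ∈ Set.Icc (θL ^ 2) (θU ^ 2), √x ∈ Set.Icc θL θU := fun x hx =>
      ⟨Real.le_sqrt_of_sq_le hx.1, Real.sqrt_le_iff.2 ⟨by linarith, hx.2⟩⟩
    intro x hx y hy hxy
    have := hh (hmem x hx) (hmem y hy) (Real.sqrt_le_sqrt hxy)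
    simp only at this ⊢
    linarith
  have key := (aux_sum_s15 (fun x => f (√x)) _ (θL ^ 2) (θU ^ 2) (by positivity) hg hanti (by
      rw [← two_mul, Real.sqrt_mul (by norm_num), Real.sqrt_sq hL.le]
      exact hb) (fun j => t j ^ 2) (fun j => by have := ht j; gcongr) Finset.univ
      Finset.univ_nonempty).1 hsum
  refine key.trans (le_of_eq (Finset.sum_congr rfl fun j _ => ?_))
  rw [Real.sqrt_sq (by linarith [ht j])]

/-- Corollary 1 of the paper (UniformTradingPlus): the Laplace-mechanism pricing
function `Π(q,v) = ∑ i, μ i (Δq·√(2/v))` is partially arbitrage free for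
`v ∈ [2(Δq/θU)², 2(Δq/θL)²]` under the endpoint and differential conditions
on the (possibly nonsubadditive) compensation functions. -/
theorem stmt_15 (d n : ℕ) (hd : 1 ≤ d)
    (Δ : (Fin d → ℝ) → ℝ)
    (hΔ : ∀ q : Fin d → ℝ, Δ q = (⨆ l, q l) - (⨅ l, q l))
    (θL θU : ℝ) (hL : 0 < θL) (hLU : θL ≤ θU)
    (μ : Fin n → ℝ → ℝ) (μ' μ'' : Fin n → ℝ → ℝ)
    (hμ_mono : ∀ i, Monotone (μ i))
    (hμd1 : ∀ i, ∀ θ : ℝ, 0 < θ → HasDerivAt (μ i) (μ' i θ) θ)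
    (hμd2 : ∀ i, ∀ θ : ℝ, 0 < θ → HasDerivAt (μ' i) (μ'' i θ) θ)
    (hμ0 : ∀ i, μ i 0 = 0)
    (hμ_base : ∀ i, μ i (Real.sqrt 2 * θL) ≤ 2 * μ i θL)
    (hμ_ineq : ∀ i, ∀ θ ∈ Set.Icc θL θU, θ * μ'' i θ ≤ μ' i θ)
    (price : (Fin d → ℝ) → ℝ → ℝ)
    (hprice : ∀ (q : Fin d → ℝ) (v : ℝ), 0 < v →
      price q v = ∑ i, μ i (Δ q * Real.sqrt (2 / v)))
    (m : ℕ) (hm : 1 ≤ m)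
    (q : Fin d → ℝ) (hΔq : 0 < Δ q)
    (qs : Fin m → (Fin d → ℝ)) (hΔqs : ∀ j, 0 < Δ (qs j))
    (v : ℝ)
    (hv : v ∈ Set.Icc (2 * (Δ q / θU) ^ 2) (2 * (Δ q / θL) ^ 2))
    (θs : Fin m → ℝ) (hθs : ∀ j, θs j ∈ Set.Icc θL θU)
    (hθsum : ∑ j, θs j ≤ θU)
    (vs : Fin m → ℝ) (hvs : ∀ j, vs j = 2 * (Δ (qs j) / θs j) ^ 2)
    (a : Fin m → ℝ)
    (hq : ∑ j, a j • qs j = q)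
    (hvsum : ∑ j, (a j) ^ 2 * vs j ≤ v) :
    price q v ≤ ∑ j, price (qs j) (vs j) := by
  have hU : 0 < θU := by linarith
  haveI : Nonempty (Fin d) := ⟨⟨0, hd⟩⟩
  have hθ0 : ∀ j, 0 < θs j := fun j => by linarith [(hθs j).1]
  have hv0 : 0 < v := lt_of_lt_of_le (by positivity) hv.1
  have hvs0 : ∀ j, 0 < vs j := fun j => by
    rw [hvs j]
    have := hθ0 j
    have := hΔqs j
    positivity
  have hdiff : ∀ (p : Fin d → ℝ) l k, p l - p k ≤ Δ p := by
    intro p l k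
    rw [hΔ]
    have h1 := le_ciSup (Set.finite_range p).bddAbove l
    have h2 := ciInf_le (Set.finite_range p).bddBelow k
    linarith
  have hsub : Δ q ≤ ∑ j, |a j| * Δ (qs j) := by
    obtain ⟨l, hl⟩ := exists_eq_ciSup_of_finite (f := q)
    obtain ⟨k, hk⟩ := exists_eq_ciInf_of_finite (f := q)
    rw [hΔ q, ← hl, ← hk, ← hq]
    simp only [Finset.sum_apply, Pi.smul_apply, smul_eq_mul]
    rw [← Finset.sum_sub_distrib]
    refine Finset.sum_le_sum fun j _ => ?_
    rw [← mul_sub]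
    refine (le_abs_self _).trans ?_
    rw [abs_mul]
    refine mul_le_mul_of_nonneg_left (abs_le.2 ⟨?_, hdiff _ _ _⟩) (abs_nonneg _)
    linarith [hdiff (qs j) k l]
  have hθj : ∀ j, Δ (qs j) * √(2 / vs j) = θs j := by
    intro j
    have h1 := hθ0 j
    have h2 := hΔqs j
    have : 2 / vs j = (θs j / Δ (qs j)) ^ 2 := by
      rw [hvs j]; field_simp
    rw [this, Real.sqrt_sq (by positivity)]
    field_simp
  have hmain : 2 * (Δ q) ^ 2 ≤ (∑ j, θs j ^ 2) * v := by
    have hcs := Finset.sum_mul_sq_le_sq_mul_sq Finset.univ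
      (fun j => |a j| * Δ (qs j) / θs j) θs
    have e1 : ∑ j, |a j| * Δ (qs j) / θs j * θs j = ∑ j, |a j| * Δ (qs j) :=
      Finset.sum_congr rfl fun j _ => div_mul_cancel₀ _ (hθ0 j).ne'
    have e2 : ∑ j, (a j) ^ 2 * vs j = 2 * ∑ j, (|a j| * Δ (qs j) / θs j) ^ 2 := by
      rw [Finset.mul_sum]
      refine Finset.sum_congr rfl fun j _ => ?_
      rw [hvs j, div_pow, div_pow, mul_pow, sq_abs]
      ring
    rw [e1] at hcs
    rw [e2] at hvsum
    have h3 : (Δ q) ^ 2 ≤ (∑ j, |a j| * Δ (qs j)) ^ 2 := by gcongr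
    have h4 : 0 ≤ ∑ j, θs j ^ 2 := Finset.sum_nonneg fun j _ => sq_nonneg _
    have h5 := mul_le_mul_of_nonneg_left hvsum h4
    linarith
  have hle : Δ q * √(2 / v) ≤ √(∑ j, θs j ^ 2) := by
    apply Real.le_sqrt_of_sq_le
    rw [mul_pow, Real.sq_sqrt (by positivity), ← mul_div_assoc, div_le_iff₀ hv0]
    linarith
  have hsq : ∑ j, θs j ^ 2 ≤ θU ^ 2 := by
    have h1 : ∑ j, θs j ^ 2 ≤ (∑ j, θs j) ^ 2 := 
      Finset.sum_sq_le_sq_sum_of_nonneg fun j _ => (hθ0 j).le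
    have h2 : 0 ≤ ∑ j, θs j := Finset.sum_nonneg fun j _ => (hθ0 j).le
    have h3 : (∑ j, θs j) ^ 2 ≤ θU ^ 2 := by gcongr
    exact h1.trans h3
  have hR : ∑ j, price (qs j) (vs j) = ∑ i, ∑ j, μ i (θs j) := by
    rw [Finset.sum_comm]
    refine Finset.sum_congr rfl fun j _ => ?_
    rw [hprice _ _ (hvs0 j), hθj j]
  rw [hprice q v hv0, hR]
  refine Finset.sum_le_sum fun i _ => (hμ_mono i hle).trans ?_
  exact aux_mu (μ i) (μ' i) (μ'' i) θL θU hL (hμd1 i) (hμd2 i) (hμ_base i) (hμ_ineq i) m hm θs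
    (fun j => (hθs j).1) hsq hLU
end

section
/- Let λ : ℝ^d → ℝ be a seminorm and let 0 < x_L ≤ x_U with 2·x_L ≤ x_U. For i = 1,…,n let h_i : ℝ → ℝ be nondecreasing on [0, x_U], twice differentiable on [x_L, x_U] with h_i''(x) ≤ 0 for all x ∈ [x_L, x_U], and satisfying h_i(2·x_L) ≤ 2·h_i(x_L). Define Π(q, v) = ∑_{i=1}^n h_i(λ(q)²/v) for v > 0. Then for every m ≥ 1, every q, q_1, …, q_m ∈ ℝ^d and v, v_1, …, v_m > 0 with λ(q_j)²/v_j ∈ [x_L, x_U] for each j, ∑_{j=1}^m λ(q_j)²/v_j ≤ x_U, and λ(q)²/v ≤ x_U, and every a_1, …, a_m ∈ ℝ with ∑_{j=1}^m a_j·q_j = q and ∑_{j=1}^m a_j²·v_j ≤ v, one has Π(q, v) ≤ ∑_{j=1}^m Π(q_j, v_j). -/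
theorem aux_shift_s17 (f : ℝ → ℝ) (A B : ℝ) (hf : ConcaveOn ℝ (Set.Icc A B) f) (s t δ : ℝ)
    (hs : A ≤ s) (hst : s ≤ t) (hδ : 0 < δ) (ht : t + δ ≤ B) :
    f (t + δ) + f s ≤ f t + f (s + δ) := by
  have hL : 0 < t + δ - s := by linarith
  have hne : t + δ - s ≠ 0 := hL.ne'
  have m1 : s ∈ Set.Icc A B := ⟨hs, by linarith⟩
  have m2 : t + δ ∈ Set.Icc A B := ⟨by linarith, ht⟩
  have p1 : 0 ≤ δ / (t + δ - s) := by positivity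
  have p2 : 0 ≤ (t - s) / (t + δ - s) := div_nonneg (by linarith) hL.le
  have e : δ / (t + δ - s) + (t - s) / (t + δ - s) = 1 := by field_simp; ring
  have c1 := hf.2 m1 m2 p1 p2 e
  have c2 := hf.2 m1 m2 p2 p1 (by rw [add_comm]; exact e)
  simp only [smul_eq_mul] at c1 c2
  have e1 : δ / (t + δ - s) * s + (t - s) / (t + δ - s) * (t + δ) = t := by
    field_simp; ring
  have e2 : (t - s) / (t + δ - s) * s + δ / (t + δ - s) * (t + δ) = s + δ := by
    field_simp; ring
  rw [e1] at c1
  rw [e2] at c2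
  have h3 : (δ / (t + δ - s) + (t - s) / (t + δ - s)) * (f s + f (t + δ)) = f s + f (t + δ) := by
    rw [e, one_mul]
  nlinarith

theorem aux_sub (f : ℝ → ℝ) (A B : ℝ) (hA : 0 < A) (hf : ConcaveOn ℝ (Set.Icc A B) f)
    (hb : f (2 * A) ≤ 2 * f A) (x y : ℝ) (hx : A ≤ x) (hy : A ≤ y) (hxy : x + y ≤ B) :
    f (x + y) ≤ f x + f y := by
  have h1 := aux_shift_s17 f A B hf A y x le_rfl hy (by linarith) (by linarith)
  have h2 := aux_shift_s17 f A B hf A x A le_rfl hx hA (by linarith)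
  rw [add_comm y x, add_comm A x] at h1
  rw [← two_mul] at h2
  linarith

theorem aux_sum_s17 (f : ℝ → ℝ) (A B : ℝ) (hA : 0 < A) (hf : ConcaveOn ℝ (Set.Icc A B) f)
    (hb : f (2 * A) ≤ 2 * f A) {ι : Type*} (y : ι → ℝ) (hy : ∀ j, A ≤ y j) (s : Finset ι)
    (hs : s.Nonempty) : ∑ j ∈ s, y j ≤ B → A ≤ ∑ j ∈ s, y j ∧
      f (∑ j ∈ s, y j) ≤ ∑ j ∈ s, f (y j) := by
  induction hs using Finset.Nonempty.cons_induction with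
  | singleton a => intro _; simpa using hy a
  | cons a s ha hs ih =>
    intro hB
    rw [Finset.sum_cons] at hB
    have hya := hy a
    obtain ⟨i1, i2⟩ := ih (by linarith)
    rw [Finset.sum_cons, Finset.sum_cons]
    have := aux_sub f A B hA hf hb _ _ hya i1 hB
    exact ⟨by linarith, by linarith⟩

/-- Conclusion of Theorem 3 of the paper: micro-payments `h i` that are
nondecreasing on `[0, xU]`, concave on `[xL, xU]` and satisfy the doubling
condition `h i (2xL) ≤ 2·h i (xL)` yield a partially arbitrage-free pricing
function `Π(q,v) = ∑ i, h i (λ(q)²/v)`. -/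
theorem stmt_17 (d n : ℕ)
    (lam : (Fin d → ℝ) → ℝ)
    (hlam_smul : ∀ (c : ℝ) (q : Fin d → ℝ), lam (c • q) = |c| * lam q)
    (hlam_add : ∀ q q' : Fin d → ℝ, lam (q + q') ≤ lam q + lam q')
    (xL xU : ℝ) (hxL : 0 < xL) (hxLU : xL ≤ xU) (hdouble : 2 * xL ≤ xU)
    (h h' h'' : Fin n → ℝ → ℝ)
    (hh_mono : ∀ i, ∀ x y : ℝ, 0 ≤ x → x ≤ y → y ≤ xU → h i x ≤ h i y)
    (hhd1 : ∀ i, ∀ x ∈ Set.Icc xL xU, HasDerivAt (h i) (h' i x) x)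
    (hhd2 : ∀ i, ∀ x ∈ Set.Icc xL xU, HasDerivAt (h' i) (h'' i x) x)
    (hconc : ∀ i, ∀ x ∈ Set.Icc xL xU, h'' i x ≤ 0)
    (hbase : ∀ i, h i (2 * xL) ≤ 2 * h i xL)
    (price : (Fin d → ℝ) → ℝ → ℝ)
    (hprice : ∀ (q : Fin d → ℝ) (v : ℝ), 0 < v →
      price q v = ∑ i, h i (lam q ^ 2 / v))
    (m : ℕ) (hm : 1 ≤ m)
    (q : Fin d → ℝ) (qs : Fin m → (Fin d → ℝ))
    (v : ℝ) (vs : Fin m → ℝ) (hv : 0 < v) (hvs : ∀ j, 0 < vs j)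
    (hrange : ∀ j, lam (qs j) ^ 2 / vs j ∈ Set.Icc xL xU)
    (hsum_range : ∑ j, lam (qs j) ^ 2 / vs j ≤ xU)
    (hq_range : lam q ^ 2 / v ≤ xU)
    (a : Fin m → ℝ)
    (hq : ∑ j, a j • qs j = q)
    (hvsum : ∑ j, (a j) ^ 2 * vs j ≤ v) :
    price q v ≤ ∑ j, price (qs j) (vs j) := by
  have hlam0 : lam 0 = 0 := by simpa using hlam_smul 0 0
  have hnn : ∀ p, 0 ≤ lam p := by
    intro p
    have h1 := hlam_add p ((-1 : ℝ) • p)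
    rw [hlam_smul] at h1
    simp [hlam0] at h1
    exact h1
  have hle : lam q ≤ ∑ j, |a j| * lam (qs j) := by
    rw [← hq]
    refine (Finset.le_sum_of_subadditive lam hlam0.le hlam_add _ _).trans ?_
    exact (Finset.sum_congr rfl fun j _ => hlam_smul _ _).le
  have hcs : (∑ j, |a j| * lam (qs j)) ^ 2 ≤
      (∑ j, (a j) ^ 2 * vs j) * ∑ j, lam (qs j) ^ 2 / vs j := by
    refine Finset.sum_sq_le_sum_mul_sum_of_sq_eq_mul _ (fun j _ => ?_) (fun j _ => ?_)
      (fun j _ => ?_)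
    · have := hvs j; positivity
    · have := hvs j; positivity
    · have := (hvs j).ne'
      rw [mul_pow, sq_abs]; field_simp
  have hS0 : 0 ≤ ∑ j, lam (qs j) ^ 2 / vs j :=
    Finset.sum_nonneg fun j _ => hxL.le.trans (hrange j).1
  have hkey : lam q ^ 2 / v ≤ ∑ j, lam (qs j) ^ 2 / vs j := by
    rw [div_le_iff₀ hv, mul_comm]
    exact (pow_le_pow_left₀ (hnn q) hle 2).trans
      (hcs.trans (mul_le_mul_of_nonneg_right hvsum hS0))
  rw [hprice q v hv, Finset.sum_congr rfl fun j _ => hprice (qs j) (vs j) (hvs j),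
    Finset.sum_comm]
  refine Finset.sum_le_sum fun i _ => ?_
  refine (hh_mono i _ _ (by positivity) hkey hsum_range).trans ?_
  have hc : ConcaveOn ℝ (Set.Icc xL xU) (h i) := by
    refine concaveOn_of_hasDerivWithinAt2_nonpos (f' := h' i) (f'' := h'' i) (convex_Icc _ _)
      (fun x hx => (hhd1 i x hx).continuousAt.continuousWithinAt)
      (fun x hx => (hhd1 i x (interior_subset hx)).hasDerivWithinAt)
      (fun x hx => (hhd2 i x (interior_subset hx)).hasDerivWithinAt)
      (fun x hx => hconc i x (interior_subset hx))
  exact (aux_sum_s17 (h i) xL xU hxL hc (hbase i) (fun j => lam (qs j) ^ 2 / vs j)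
    (fun j => (hrange j).1) Finset.univ ⟨⟨0, hm⟩, Finset.mem_univ _⟩ hsum_range).2
end
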